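/- Let l, a, τ, T > 0 and c ∈ ℝ with c < (πa/l)², set ω_n = √((πna/l)² − c) for each integer n ≥ 1 and m = ⌈T/τ⌉. Let (p_n) and (q_n) be real sequences such that for some α > 0, lim_{n→∞} (|p_n| + |q_n|) n^{2m+3+α} = 0. Then the series S₁(t, x) = Σ_{n=1}^{∞} (p_n cos_τ(ω_n, t) + (q_n/ω_n) sin_τ(ω_n, t)) sin(πnx/l) converges absolutely and uniformly on [0, T] × [0, l]; moreover, the series obtained from it by term-wise application of any partial derivative in t and x of total order at most 2 also converge absolutely and uniformly on compact subsets of (0, T) × [0, l], the sum S₁ is twice continuously differentiable on (0, T) × (0, l), and its partial derivatives of order at most 2 are given by term-wise differentiation. -/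

import Mathlib

open Real Set Filter Topology MeasureTheory

/-- `C` is the delay cosine function `cos_τ(ω, ·)`: it vanishes for `t < -τ` and, for every
integer `k ≥ 0` and `(k-1)τ ≤ t < kτ`, equals
`∑_{j=0}^{k} (-1)^j ω^(2j) (t-(j-1)τ)^(2j) / (2j)!`. -/
def IsDelayCos (τ ω : ℝ) (C : ℝ → ℝ) : Prop :=
  (∀ t : ℝ, t < -τ → C t = 0) ∧
  ∀ (k : ℕ) (t : ℝ), ((k : ℝ) - 1) * τ ≤ t → t < (k : ℝ) * τ →
    C t = ∑ j ∈ Finset.range (k + 1),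
      (-1 : ℝ) ^ j * ω ^ (2 * j) * (t - ((j : ℝ) - 1) * τ) ^ (2 * j) / ((2 * j).factorial : ℝ)

/-- `S` is the delay sine function `sin_τ(ω, ·)`: it vanishes for `t < -τ` and, for every
integer `k ≥ 0` and `(k-1)τ ≤ t < kτ`, equals
`∑_{j=0}^{k} (-1)^j ω^(2j+1) (t-(j-1)τ)^(2j+1) / (2j+1)!`. -/
def IsDelaySin (τ ω : ℝ) (S : ℝ → ℝ) : Prop :=
  (∀ t : ℝ, t < -τ → S t = 0) ∧
  ∀ (k : ℕ) (t : ℝ), ((k : ℝ) - 1) * τ ≤ t → t < (k : ℝ) * τ →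
    S t = ∑ j ∈ Finset.range (k + 1),
      (-1 : ℝ) ^ j * ω ^ (2 * j + 1) * (t - ((j : ℝ) - 1) * τ) ^ (2 * j + 1) / ((2 * j + 1).factorial : ℝ)

/-- The partial derivative `∂_t^i ∂_x^j F` of a function `F` of two real variables. -/
noncomputable def pd (i j : ℕ) (F : ℝ → ℝ → ℝ) (t x : ℝ) : ℝ :=
  iteratedDeriv i (fun t' => iteratedDeriv j (fun x' => F t' x') x) t

theorem abs_iteratedDeriv_mul_sin_le (j : ℕ) (b ν x : ℝ) :
    |iteratedDeriv j (fun x => b * Real.sin (ν * x)) x| ≤ |b| * |ν| ^ j := by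
  rw [iteratedDeriv_const_mul_field, iteratedDeriv_comp_const_mul Real.contDiff_sin, abs_mul,
    abs_mul, abs_pow]
  gcongr
  exact mul_le_of_le_one_right (by positivity) (Real.abs_iteratedDeriv_sin_le_one j _)

theorem contDiff_tsum_mul_sin {b ν : ℕ → ℝ}
    (hb : ∀ j ≤ 2, Summable fun n => |b n| * |ν n| ^ j) :
    ContDiff ℝ 2 fun x => ∑' n, b n * Real.sin (ν n * x) := by
  refine contDiff_tsum (N := 2) (v := fun j n => |b n| * |ν n| ^ j)
    (fun n => by fun_prop) (fun k hk => hb k (by exact_mod_cast hk)) ?_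
  intro k n x _
  rw [norm_iteratedFDeriv_eq_norm_iteratedDeriv]
  exact abs_iteratedDeriv_mul_sin_le _ _ _ _

theorem iteratedDeriv_tsum_mul_sin {b ν : ℕ → ℝ}
    (hb : ∀ j ≤ 2, Summable fun n => |b n| * |ν n| ^ j) {j : ℕ} (hj : j ≤ 2) (x : ℝ) :
    iteratedDeriv j (fun x => ∑' n, b n * Real.sin (ν n * x)) x =
      ∑' n, iteratedDeriv j (fun x => b n * Real.sin (ν n * x)) x := by
  have hbound : ∀ (k n : ℕ) (x : ℝ), (k : ℕ∞) ≤ 2 →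
      ‖iteratedFDeriv ℝ k (fun x => b n * Real.sin (ν n * x)) x‖ ≤ |b n| * |ν n| ^ k := by
    intro k n x _
    rw [norm_iteratedFDeriv_eq_norm_iteratedDeriv]
    exact abs_iteratedDeriv_mul_sin_le _ _ _ _
  have hj' : (j : ℕ∞) ≤ 2 := by exact_mod_cast hj
  have hsum : ∀ k : ℕ, (k : ℕ∞) ≤ 2 → Summable fun n => |b n| * |ν n| ^ k :=
    fun k hk => hb k (by exact_mod_cast hk)
  simp only [iteratedDeriv]
  rw [iteratedFDeriv_tsum_apply (N := 2) (v := fun k n => |b n| * |ν n| ^ k)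
    (fun n => by fun_prop) hsum hbound hj', ContinuousMultilinearMap.tsum_eval]
  exact .of_norm_bounded (hsum j hj') fun n => hbound j n x hj'

/-- The partial derivatives of order at most two of a finite sum of products. -/
theorem pd_sum_mul {ι : Type*} (s : Finset ι) {T : ℝ} {G : ℝ → ℝ → ℝ} {F h : ι → ℝ → ℝ}
    (hF : ∀ k, ContDiff ℝ 2 (F k)) (hh : ∀ k, ContDiff ℝ 2 (h k))
    (hG : ∀ t ∈ Icc 0 T, ∀ x, G t x = ∑ k ∈ s, F k t * h k x)
    {i j : ℕ} (hi : i ≤ 2) (hj : j ≤ 2) {t : ℝ} (ht : t ∈ Ioo 0 T) (x : ℝ) :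
    pd i j G t x = ∑ k ∈ s, iteratedDeriv i (F k) t * iteratedDeriv j (h k) x := by
  have hi' : (i : WithTop ℕ∞) ≤ 2 := by exact_mod_cast hi
  have hj' : (j : WithTop ℕ∞) ≤ 2 := by exact_mod_cast hj
  have hx : (fun t' => iteratedDeriv j (fun x' => G t' x') x) =ᶠ[𝓝 t]
      fun t' => ∑ k ∈ s, F k t' * iteratedDeriv j (h k) x := by
    filter_upwards [isOpen_Ioo.mem_nhds ht] with t' ht'
    rw [funext (hG t' (Ioo_subset_Icc_self ht')), iteratedDeriv_fun_sum]
    · exact Finset.sum_congr rfl fun k _ => iteratedDeriv_const_mul_field _ _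
    · exact fun k _ => contDiff_const.contDiffAt.mul ((hh k).of_le hj').contDiffAt
  rw [pd, hx.iteratedDeriv_eq i, iteratedDeriv_fun_sum]
  · exact Finset.sum_congr rfl fun k _ => iteratedDeriv_mul_const_field _ _
  · exact fun k _ => ((hF k).of_le hi').contDiffAt.mul contDiff_const.contDiffAt

/-- A Weierstrass test for series whose terms are finite sums of products. -/
theorem weierstrass_sum_mul {ι : Type*} (s : Finset ι) {T : ℝ} {w : ℕ → ℝ → ℝ → ℝ}
    {F : ι → ℝ → ℝ} {h : ℕ → ι → ℝ → ℝ} {M : ℕ → ι → ℝ} (hF : ∀ k, Continuous (F k))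
    (hh : ∀ n k x, |h n k x| ≤ M n k) (hM : ∀ k, Summable fun n => M n k)
    {K : Set (ℝ × ℝ)} (hK : ∀ pt ∈ K, pt.1 ∈ Icc 0 T)
    (hw : ∀ n, ∀ pt ∈ K, w n pt.1 pt.2 = ∑ k ∈ s, F k pt.1 * h n k pt.2) :
    (∀ pt ∈ K, Summable fun n => |w n pt.1 pt.2|) ∧
    TendstoUniformlyOn (fun N (pt : ℝ × ℝ) => ∑ n ∈ Finset.range N, w n pt.1 pt.2)
      (fun pt => ∑' n, w n pt.1 pt.2) atTop K := by
  choose C hC using fun k =>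
    (isCompact_Icc (a := (0 : ℝ)) (b := T)).exists_bound_of_continuousOn (hF k).continuousOn
  have hsum : Summable fun n => ∑ k ∈ s, C k * M n k :=
    summable_sum fun k _ => (hM k).mul_left _
  have hle : ∀ n, ∀ pt ∈ K, |w n pt.1 pt.2| ≤ ∑ k ∈ s, C k * M n k := by
    intro n pt hpt
    rw [hw n pt hpt]
    refine (Finset.abs_sum_le_sum_abs _ _).trans (Finset.sum_le_sum fun k _ => ?_)
    have hCk := hC k pt.1 (hK pt hpt)
    rw [abs_mul]
    exact mul_le_mul hCk (hh n k _) (abs_nonneg _) ((norm_nonneg _).trans hCk)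
  exact ⟨fun pt hpt => hsum.of_nonneg_of_le (fun _ => abs_nonneg _) fun n => hle n pt hpt,
    tendstoUniformlyOn_tsum_nat hsum hle⟩

/-- Differentiation of `∑ₙ ∑ₖ bₙₖ Fₖ(t) sin(νₙ x)` term by term. -/
theorem sine_series_term_by_term {ι : Type*} (s : Finset ι) {T : ℝ} {v : ℕ → ℝ → ℝ → ℝ}
    {F : ι → ℝ → ℝ} {b : ℕ → ι → ℝ} {ν : ℕ → ℝ} (hF : ∀ k, ContDiff ℝ 2 (F k))
    (hb : ∀ k, ∀ j ≤ 2, Summable fun n => |b n k| * |ν n| ^ j)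
    (hv : ∀ n, ∀ t ∈ Icc 0 T, ∀ x, v n t x = ∑ k ∈ s, F k t * (b n k * Real.sin (ν n * x))) :
    (∀ K ⊆ {pt : ℝ × ℝ | pt.1 ∈ Icc 0 T},
      (∀ pt ∈ K, Summable fun n => |v n pt.1 pt.2|) ∧
      TendstoUniformlyOn (fun N (pt : ℝ × ℝ) => ∑ n ∈ Finset.range N, v n pt.1 pt.2)
        (fun pt => ∑' n, v n pt.1 pt.2) atTop K) ∧
    (∀ i ≤ 2, ∀ j ≤ 2, ∀ K ⊆ {pt : ℝ × ℝ | pt.1 ∈ Ioo 0 T},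
      (∀ pt ∈ K, Summable fun n => |pd i j (v n) pt.1 pt.2|) ∧
      TendstoUniformlyOn (fun N (pt : ℝ × ℝ) => ∑ n ∈ Finset.range N, pd i j (v n) pt.1 pt.2)
        (fun pt => ∑' n, pd i j (v n) pt.1 pt.2) atTop K) ∧
    ContDiffOn ℝ 2 (fun pt : ℝ × ℝ => ∑' n, v n pt.1 pt.2) {pt | pt.1 ∈ Ioo 0 T} ∧
    ∀ i ≤ 2, ∀ j ≤ 2, ∀ t ∈ Ioo 0 T, ∀ x,
      pd i j (fun t x => ∑' n, v n t x) t x = ∑' n, pd i j (v n) t x := by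
  have hsin : ∀ n k, ContDiff ℝ 2 fun x => b n k * Real.sin (ν n * x) :=
    fun n k => by fun_prop
  have hpd : ∀ n, ∀ i ≤ 2, ∀ j ≤ 2, ∀ t ∈ Ioo 0 T, ∀ x, pd i j (v n) t x =
      ∑ k ∈ s, iteratedDeriv i (F k) t * iteratedDeriv j (fun x => b n k * Real.sin (ν n * x)) x :=
    fun n i hi j hj t ht x => pd_sum_mul s hF (hsin n) (hv n) hi hj ht x
  have hsummable : ∀ k, ∀ j ≤ 2, ∀ x,
      Summable fun n => iteratedDeriv j (fun x => b n k * Real.sin (ν n * x)) x :=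
    fun k j hj x => .of_norm_bounded (hb k j hj) fun n => abs_iteratedDeriv_mul_sin_le _ _ _ _
  have htsum : ∀ t ∈ Icc 0 T, ∀ x, ∑' n, v n t x =
      ∑ k ∈ s, F k t * ∑' n, b n k * Real.sin (ν n * x) := by
    intro t ht x
    simp_rw [fun n => hv n t ht x]
    rw [Summable.tsum_finsetSum fun k _ => ?_]
    · simp_rw [tsum_mul_left]
    · exact (by simpa using hsummable k 0 (by norm_num) x : Summable _).mul_left _
  have hH := fun k => contDiff_tsum_mul_sin (hb k)
  refine ⟨fun K hK => ?_, fun i hi j hj K hK => ?_, ?_, fun i hi j hj t ht x => ?_⟩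
  · refine weierstrass_sum_mul s (h := fun n k x => b n k * Real.sin (ν n * x))
      (fun k => (hF k).continuous) (fun n k x => ?_)
      (fun k => hb k 0 (by norm_num)) hK fun n pt hpt => hv n _ (hK hpt) _
    simpa using abs_iteratedDeriv_mul_sin_le 0 (b n k) (ν n) x
  · exact weierstrass_sum_mul s
      (fun k => (hF k).continuous_iteratedDeriv i (by exact_mod_cast hi))
      (fun n k x => abs_iteratedDeriv_mul_sin_le j (b n k) (ν n) x)
      (fun k => hb k j hj) (fun pt hpt => Ioo_subset_Icc_self (hK hpt))
      fun n pt hpt => hpd n i hi j hj _ (hK hpt) _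
  · refine ContDiffOn.congr (f := fun pt : ℝ × ℝ =>
      ∑ k ∈ s, F k pt.1 * ∑' n, b n k * Real.sin (ν n * pt.2)) ?_
      fun pt hpt => htsum _ (Ioo_subset_Icc_self hpt) _
    exact (ContDiff.sum fun k _ =>
      ((hF k).comp contDiff_fst).mul ((hH k).comp contDiff_snd)).contDiffOn
  · rw [pd_sum_mul s hF hH htsum hi hj ht x]
    simp_rw [fun n => hpd n i hi j hj t ht x]
    rw [Summable.tsum_finsetSum fun k _ => (hsummable k j hj x).mul_left _]
    refine Finset.sum_congr rfl fun k _ => ?_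
    rw [tsum_mul_left, iteratedDeriv_tsum_mul_sin (hb k) hj]

theorem hasDerivAt_max_zero_pow {e : ℕ} (he : 1 ≤ e) (s : ℝ) :
    HasDerivAt (fun s : ℝ => max s 0 ^ (e + 1)) ((e + 1) * max s 0 ^ e) s := by
  rcases lt_trichotomy s 0 with hs | rfl | hs
  · have h : (fun s : ℝ => max s 0 ^ (e + 1)) =ᶠ[𝓝 s] fun _ => 0 := by
      filter_upwards [gt_mem_nhds hs] with y hy
      simp [max_eq_right hy.le]
    rw [max_eq_right hs.le, zero_pow (by lia), mul_zero]
    exact (hasDerivAt_const s (0 : ℝ)).congr_of_eventuallyEq h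
  · have h : (fun s : ℝ => max s 0 ^ (e + 1)) =O[𝓝 0] fun s => |s - 0| ^ (e + 1) := by
      refine Asymptotics.isBigO_of_le _ fun y => ?_
      rw [norm_pow, norm_pow, sub_zero]
      gcongr
      simpa using abs_max_le_max_abs_abs (a := y) (b := 0)
    simpa [zero_pow (show e ≠ 0 by lia)] using
      (h.hasFDerivAt (by lia : 1 < e + 1)).hasDerivAt
  · have h : (fun s : ℝ => max s 0 ^ (e + 1)) =ᶠ[𝓝 s] fun s => s ^ (e + 1) := by
      filter_upwards [lt_mem_nhds hs] with y hy
      rw [max_eq_left hy.le]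
    rw [max_eq_left hs.le]
    simpa using (hasDerivAt_pow (e + 1) s).congr_of_eventuallyEq h

theorem contDiff_max_zero_pow (k e : ℕ) :
    ContDiff ℝ k fun s : ℝ => max s 0 ^ (k + 1 + e) := by
  induction k generalizing e with
  | zero =>
    exact contDiff_zero.2 (by fun_prop)
  | succ k ih =>
    have hd := fun s : ℝ => hasDerivAt_max_zero_pow (e := k + 1 + e) (by lia) s
    rw [show k + 1 + 1 + e = k + 1 + e + 1 by ring]
    push_cast
    refine contDiff_succ_iff_deriv.2 ⟨fun s => (hd s).differentiableAt, by simp, ?_⟩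
    rw [funext fun s => (hd s).deriv]
    exact contDiff_const.mul (ih e)

/-- The power `(t - (⌊d/2⌋ - 1)τ)^d`, truncated to `t ≥ (⌊d/2⌋ - 1)τ` when `d ≥ 4`: on `t ≥ 0`, the
powers from which the delay sine and cosine are built. -/
noncomputable def delayPow (τ : ℝ) (d : ℕ) (t : ℝ) : ℝ :=
  if d < 4 then (t - (((d / 2 : ℕ) : ℝ) - 1) * τ) ^ d
  else max (t - (((d / 2 : ℕ) : ℝ) - 1) * τ) 0 ^ d

theorem contDiff_delayPow (τ : ℝ) (d : ℕ) : ContDiff ℝ 2 (delayPow τ d) := by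
  unfold delayPow
  split_ifs with hd
  · fun_prop
  · obtain ⟨e, rfl⟩ : ∃ e, d = 2 + 1 + e := ⟨d - 3, by lia⟩
    exact (contDiff_max_zero_pow 2 e).comp (g := fun s : ℝ => max s 0 ^ (2 + 1 + e))
      (by fun_prop : ContDiff ℝ 2 fun t : ℝ => t - (((2 + 1 + e) / 2 : ℕ) - 1 : ℝ) * τ)

theorem delayPow_of_le {τ t : ℝ} {d : ℕ} (h : (((d / 2 : ℕ) : ℝ) - 1) * τ ≤ t) :
    delayPow τ d t = (t - (((d / 2 : ℕ) : ℝ) - 1) * τ) ^ d := by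
  rw [delayPow, max_eq_left (sub_nonneg.2 h), ite_self]

theorem delayPow_of_ge {τ t : ℝ} {d : ℕ} (hd : 4 ≤ d) (h : t ≤ (((d / 2 : ℕ) : ℝ) - 1) * τ) :
    delayPow τ d t = 0 := by
  rw [delayPow, if_neg (by lia), max_eq_right (sub_nonpos.2 h), zero_pow (by lia)]

theorem sum_range_eq_of_eq_zero {f : ℕ → ℝ} {M N : ℕ} (hM : ∀ j, M ≤ j → f j = 0)
    (hN : ∀ j, N ≤ j → f j = 0) : ∑ j ∈ Finset.range M, f j = ∑ j ∈ Finset.range N, f j := by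
  wlog h : M ≤ N generalizing M N
  · exact (this hN hM (le_of_not_ge h)).symm
  · exact Finset.sum_subset (Finset.range_mono h) fun j _ hj => hM j (by simpa using hj)

/-- The delay cosine (`e = 0`) and delay sine (`e = 1`) on `[0, T]` as a fixed finite sum. -/
theorem delay_eq_sum_delayPow {τ ω T t : ℝ} (hτ : 0 < τ) {e m : ℕ} (he : e ≤ 1) (hm : 1 ≤ m)
    (hT : T ≤ m * τ) {C : ℝ → ℝ}
    (hC : ∀ (k : ℕ) (t : ℝ), ((k : ℝ) - 1) * τ ≤ t → t < (k : ℝ) * τ →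
      C t = ∑ j ∈ Finset.range (k + 1), (-1 : ℝ) ^ j * ω ^ (2 * j + e) *
        (t - ((j : ℝ) - 1) * τ) ^ (2 * j + e) / ((2 * j + e).factorial : ℝ))
    (ht : t ∈ Icc 0 T) :
    C t = ∑ j ∈ Finset.range (m + 1),
      (-1 : ℝ) ^ j * ω ^ (2 * j + e) * delayPow τ (2 * j + e) t / ((2 * j + e).factorial : ℝ) := by
  have hdiv : ∀ j, (2 * j + e) / 2 = j := fun j => by lia
  have hzero : ∀ k : ℕ, 1 ≤ k → t ≤ k * τ → ∀ j, k + 1 ≤ j → (-1 : ℝ) ^ j * ω ^ (2 * j + e) *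
      delayPow τ (2 * j + e) t / ((2 * j + e).factorial : ℝ) = 0 := by
    intro k hk htk j hj
    have hkj : (k : ℝ) + 1 ≤ j := by exact_mod_cast hj
    rw [delayPow_of_ge (by lia), mul_zero, zero_div]
    rw [hdiv]
    nlinarith
  have hfloor := Nat.floor_le (div_nonneg ht.1 hτ.le)
  have hlt := Nat.lt_floor_add_one (t / τ)
  set r := ⌊t / τ⌋₊
  rw [le_div_iff₀ hτ] at hfloor
  rw [div_lt_iff₀ hτ] at hlt
  rw [hC (r + 1) t (by push_cast; linarith) (by push_cast; linarith)]
  rw [← sum_range_eq_of_eq_zero (hzero (r + 1) (by lia) (by push_cast; linarith))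
    (hzero m hm (ht.2.trans hT))]
  refine Finset.sum_congr rfl fun j hj => ?_
  have hjr : (j : ℝ) ≤ r + 1 := by
    exact_mod_cast Nat.lt_succ_iff.1 (Finset.mem_range.1 hj)
  rw [delayPow_of_le, hdiv]
  rw [hdiv]
  nlinarith

theorem sum_range_two_mul_eq (f : ℕ → ℝ) (N : ℕ) : ∑ d ∈ Finset.range (2 * N), f d =
    ∑ j ∈ Finset.range N, f (2 * j) + ∑ j ∈ Finset.range N, f (2 * j + 1) := by
  induction N with
  | zero => simp
  | succ N ih =>
    rw [mul_add, mul_one, Finset.sum_range_succ, Finset.sum_range_succ, ih,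
      Finset.sum_range_succ, Finset.sum_range_succ]
    ring

/-- The coefficient of `delayPow τ d` in `p cos_τ(ω, ·) + (q/ω) sin_τ(ω, ·)`. -/
noncomputable def delayCoeff (p q ω : ℝ) (d : ℕ) : ℝ :=
  (-1) ^ (d / 2) * ω ^ (2 * (d / 2)) * (if Even d then p else q) / d.factorial

theorem delay_mode_eq_sum {τ ω T t p q : ℝ} (hτ : 0 < τ) (hω : 0 < ω) {m : ℕ} (hm : 1 ≤ m)
    (hT : T ≤ m * τ) {C S : ℝ → ℝ} (hC : IsDelayCos τ ω C) (hS : IsDelaySin τ ω S)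
    (ht : t ∈ Icc 0 T) :
    p * C t + q / ω * S t =
      ∑ d ∈ Finset.range (2 * (m + 1)), delayCoeff p q ω d * delayPow τ d t := by
  rw [sum_range_two_mul_eq, delay_eq_sum_delayPow (e := 0) hτ (by lia) hm hT hC.2 ht,
    delay_eq_sum_delayPow (e := 1) hτ le_rfl hm hT hS.2 ht, Finset.mul_sum, Finset.mul_sum]
  congr 1 <;> refine Finset.sum_congr rfl fun j _ => ?_
  · rw [delayCoeff, if_pos (by simp), Nat.mul_div_cancel_left j two_pos, add_zero]
    ring
  · rw [delayCoeff, if_neg (by simp), show (2 * j + 1) / 2 = j by lia]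
    rw [pow_succ ω]
    field_simp

theorem abs_delayCoeff_le {p q ω B : ℝ} (hω : 0 ≤ ω) (hB : 1 ≤ B) (hωB : ω ≤ B) {d m : ℕ}
    (hd : d < 2 * (m + 1)) : |delayCoeff p q ω d| ≤ B ^ (2 * m) * (|p| + |q|) := by
  have hfac : (1 : ℝ) ≤ d.factorial := by exact_mod_cast d.factorial_pos
  rw [delayCoeff, abs_div, abs_mul, abs_mul, abs_pow, abs_neg, abs_one, one_pow, one_mul,
    abs_pow, abs_of_nonneg hω, Nat.abs_cast]
  refine (div_le_self (by positivity) hfac).trans (mul_le_mul ?_ ?_ (by positivity)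
    (by positivity))
  · exact (pow_le_pow_left₀ hω hωB _).trans (pow_le_pow_right₀ hB (by lia))
  · split_ifs
    · linarith [abs_nonneg q]
    · linarith [abs_nonneg p]

theorem summable_mul_pow_of_tendsto {r : ℕ → ℝ} (hr : ∀ n, 0 ≤ r n) {N : ℕ} {α : ℝ} (hα : 0 < α)
    (h : Tendsto (fun n : ℕ => r n * (n : ℝ) ^ ((N : ℝ) + 1 + α)) atTop (𝓝 0)) :
    Summable fun n : ℕ => r n * (n : ℝ) ^ N := by
  refine summable_of_isBigO_nat (Real.summable_nat_rpow.2 (show -1 - α < -1 by linarith)) ?_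
  refine Asymptotics.IsBigO.of_bound 1 ?_
  filter_upwards [h.eventually_le_const one_pos, eventually_ge_atTop 1] with n hn hn1
  have hn0 : (0 : ℝ) < n := by exact_mod_cast hn1
  have hsplit : (n : ℝ) ^ N = (n : ℝ) ^ ((N : ℝ) + 1 + α) * (n : ℝ) ^ (-1 - α) := by
    rw [← Real.rpow_add hn0, ← Real.rpow_natCast]
    congr 1
    ring
  rw [Real.norm_of_nonneg (mul_nonneg (hr n) (by positivity)),
    Real.norm_of_nonneg (by positivity), hsplit, ← mul_assoc]
  gcongr

/-- **Convergence of the first Fourier series `S₁`** in the solution of the delay wave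
equation: with `ω_n = √((πna/l)² - c)` (where `c < (πa/l)²`), `m = ⌈T/τ⌉` and coefficients
`p_n`, `q_n` satisfying `(|p_n| + |q_n|) n^(2m+3+α) → 0` for some `α > 0`, the series
`S₁(t,x) = ∑_{n≥1} (p_n cos_τ(ω_n,t) + (q_n/ω_n) sin_τ(ω_n,t)) sin(πnx/l)` converges
absolutely and uniformly on `[0,T] × [0,l]`; the term-wise partial-derivative series of
total order `≤ 2` converge absolutely and uniformly on compact subsets of `(0,T) × [0,l]`;
`S₁` is twice continuously differentiable on `(0,T) × (0,l)` and its partial derivatives of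
order `≤ 2` are obtained by term-wise differentiation. -/
theorem delay_wave_series_S1 (l a τ T c α : ℝ)
    (hl : 0 < l) (ha : 0 < a) (hτ : 0 < τ) (hT : 0 < T)
    (hc : c < (π * a / l) ^ 2) (hα : 0 < α)
    (dcos dsin : ℝ → ℝ → ℝ)
    (hdcos : ∀ ω : ℝ, 0 < ω → IsDelayCos τ ω (dcos ω))
    (hdsin : ∀ ω : ℝ, 0 < ω → IsDelaySin τ ω (dsin ω))
    (p q : ℕ → ℝ)
    (hdecay : Filter.Tendsto
      (fun n : ℕ => (|p n| + |q n|) * (n : ℝ) ^ (2 * ((⌈T / τ⌉₊ : ℕ) : ℝ) + 3 + α))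
      Filter.atTop (nhds 0)) :
    let ω : ℕ → ℝ := fun n => Real.sqrt ((π * n * a / l) ^ 2 - c)
    let u : ℕ → ℝ → ℝ → ℝ := fun n t x =>
      (p n * dcos (ω n) t + q n / ω n * dsin (ω n) t) * Real.sin (π * n * x / l)
    let S : ℝ → ℝ → ℝ := fun t x => ∑' n : ℕ, u (n + 1) t x
    (∀ t ∈ Set.Icc (0 : ℝ) T, ∀ x ∈ Set.Icc (0 : ℝ) l,
      Summable (fun n : ℕ => |u (n + 1) t x|)) ∧
    TendstoUniformlyOn
      (fun N (pt : ℝ × ℝ) => ∑ n ∈ Finset.range N, u (n + 1) pt.1 pt.2)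
      (fun pt => S pt.1 pt.2) Filter.atTop (Set.Icc 0 T ×ˢ Set.Icc 0 l) ∧
    (∀ i j : ℕ, i + j ≤ 2 →
      ∀ K : Set (ℝ × ℝ), K ⊆ Set.Ioo 0 T ×ˢ Set.Icc 0 l → IsCompact K →
        (∀ pt ∈ K, Summable (fun n : ℕ => |pd i j (u (n + 1)) pt.1 pt.2|)) ∧
        TendstoUniformlyOn
          (fun N (pt : ℝ × ℝ) => ∑ n ∈ Finset.range N, pd i j (u (n + 1)) pt.1 pt.2)
          (fun pt => ∑' n : ℕ, pd i j (u (n + 1)) pt.1 pt.2) Filter.atTop K) ∧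
    ContDiffOn ℝ 2 (fun pt : ℝ × ℝ => S pt.1 pt.2) (Set.Ioo 0 T ×ˢ Set.Ioo 0 l) ∧
    (∀ i j : ℕ, i + j ≤ 2 → ∀ t ∈ Set.Ioo (0 : ℝ) T, ∀ x ∈ Set.Ioo (0 : ℝ) l,
      pd i j S t x = ∑' n : ℕ, pd i j (u (n + 1)) t x) := by
  intro ω u S
  set m := ⌈T / τ⌉₊
  have hm : 1 ≤ m := Nat.ceil_pos.2 (by positivity)
  have hTm : T ≤ m * τ := (div_le_iff₀ hτ).1 (Nat.le_ceil _)
  have hω : ∀ n : ℕ, 0 < ω (n + 1) := by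
    intro n
    refine Real.sqrt_pos.2 (sub_pos.2 (hc.trans_le ?_))
    have h1 : (1 : ℝ) ≤ (n + 1 : ℕ) := by exact_mod_cast Nat.succ_pos n
    have h2 : π * a / l ≤ π * (n + 1 : ℕ) * a / l := by
      rw [show π * (n + 1 : ℕ) * a / l = π * a / l * (n + 1 : ℕ) by ring]
      exact le_mul_of_one_le_right (by positivity) h1
    exact pow_le_pow_left₀ (by positivity) h2 2
  set W : ℝ := √((π * a / l) ^ 2 + |c|) + 1
  have hW1 : 1 ≤ W := le_add_of_nonneg_left (Real.sqrt_nonneg _)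
  have hωW : ∀ n : ℕ, ω (n + 1) ≤ W * (n + 1 : ℕ) := by
    intro n
    have h1 : (1 : ℝ) ≤ (n + 1 : ℕ) := by exact_mod_cast Nat.succ_pos n
    calc ω (n + 1) ≤ √(((π * a / l) ^ 2 + |c|) * ((n + 1 : ℕ) : ℝ) ^ 2) := by
          refine Real.sqrt_le_sqrt ?_
          have h2 : -c ≤ |c| * ((n + 1 : ℕ) : ℝ) ^ 2 :=
            (neg_le_abs c).trans (le_mul_of_one_le_right (abs_nonneg c) (one_le_pow₀ h1))
          calc (π * (n + 1 : ℕ) * a / l) ^ 2 - c = (π * a / l) ^ 2 * ((n + 1 : ℕ) : ℝ) ^ 2 + -c := by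
                ring
            _ ≤ _ := by rw [add_mul]; gcongr
      _ = √((π * a / l) ^ 2 + |c|) * (n + 1 : ℕ) := by
          rw [Real.sqrt_mul (by positivity), Real.sqrt_sq (by positivity)]
      _ ≤ W * (n + 1 : ℕ) := by gcongr; exact le_add_of_nonneg_right zero_le_one
  set L : ℝ := π / l + 1
  have hL1 : 1 ≤ L := le_add_of_nonneg_left (by positivity)
  have hsum : Summable fun n : ℕ =>
      (|p (n + 1)| + |q (n + 1)|) * ((n + 1 : ℕ) : ℝ) ^ (2 * m + 2) := by
    refine (summable_nat_add_iff 1).2 (summable_mul_pow_of_tendsto (α := α)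
      (r := fun n => |p n| + |q n|) (fun n => by positivity) hα ?_)
    convert hdecay using 4
    push_cast
    ring
  have hb : ∀ d : Fin (2 * (m + 1)), ∀ j ≤ 2, Summable fun n =>
      |delayCoeff (p (n + 1)) (q (n + 1)) (ω (n + 1)) d| * |π * (n + 1 : ℕ) / l| ^ j := by
    intro d j hj
    refine .of_nonneg_of_le (fun n => by positivity) (fun n => ?_)
      (hsum.mul_left (W ^ (2 * m) * L ^ 2))
    have hn1 : (1 : ℝ) ≤ (n + 1 : ℕ) := by exact_mod_cast Nat.succ_pos n
    have hcoeff := abs_delayCoeff_le (p := p (n + 1)) (q := q (n + 1)) (hω n).le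
      (one_le_mul_of_one_le_of_one_le hW1 hn1) (hωW n) d.2
    have hν : |π * (n + 1 : ℕ) / l| ^ j ≤ (L * (n + 1 : ℕ)) ^ 2 := by
      refine (pow_le_pow_left₀ (abs_nonneg _) ?_ j).trans
        (pow_le_pow_right₀ (one_le_mul_of_one_le_of_one_le hL1 hn1) hj)
      rw [abs_of_nonneg (by positivity), mul_div_right_comm]
      gcongr
      exact le_add_of_nonneg_right zero_le_one
    calc |delayCoeff (p (n + 1)) (q (n + 1)) (ω (n + 1)) d| * |π * (n + 1 : ℕ) / l| ^ j
      _ ≤ (W * (n + 1 : ℕ)) ^ (2 * m) * (|p (n + 1)| + |q (n + 1)|) *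
          (L * (n + 1 : ℕ)) ^ 2 := mul_le_mul hcoeff hν (by positivity) (by positivity)
      _ = W ^ (2 * m) * L ^ 2 * ((|p (n + 1)| + |q (n + 1)|) *
          ((n + 1 : ℕ) : ℝ) ^ (2 * m + 2)) := by ring_nf
  have hv : ∀ n, ∀ t ∈ Icc 0 T, ∀ x, u (n + 1) t x = ∑ d : Fin (2 * (m + 1)), delayPow τ d t *
      (delayCoeff (p (n + 1)) (q (n + 1)) (ω (n + 1)) d *
        Real.sin (π * (n + 1 : ℕ) / l * x)) := by
    intro n t ht x
    simp only [u]
    rw [delay_mode_eq_sum hτ (hω n) hm hTm (hdcos _ (hω n)) (hdsin _ (hω n)) ht,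
      Finset.sum_range, Finset.sum_mul, mul_div_right_comm]
    exact Finset.sum_congr rfl fun d _ => by ring
  obtain ⟨h0, h1, h2, h3⟩ := sine_series_term_by_term Finset.univ
    (fun d : Fin (2 * (m + 1)) => contDiff_delayPow τ d) hb hv
  refine ⟨fun t ht x hx => ?_, ?_, fun i j hij K hK _ => ?_, ?_, fun i j hij t ht x _ => ?_⟩
  · exact (h0 (Icc 0 T ×ˢ Icc 0 l) fun pt hpt => hpt.1).1 (t, x) ⟨ht, hx⟩
  · exact (h0 _ fun pt hpt => hpt.1).2
  · exact h1 i (by lia) j (by lia) K fun pt hpt => (hK hpt).1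
  · exact h2.mono fun pt hpt => hpt.1
  · exact h3 i (by lia) j (by lia) t ht x
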